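/- (Kannan-type fixed point theorem for multi-valued maps) Let (X, p) be a complete partial metric space and let T be a map assigning to each x ∈ X a nonempty, closed (in the partial metric topology), bounded subset Tx ⊆ X. Suppose there is a constant λ ∈ (0, 1/2) such that H_p(Tx, Ty) ≤ λ·(p(Tx, x) + p(Ty, y)) for all x, y ∈ X, where p(A, x) = inf{p(a, x) : a ∈ A}. Then T has a fixed point: there exists x ∈ X with x ∈ Tx. -/

import Mathlib

/-- The topology of a partial metric space, generated by the open balls
`B_p(x, ε) = {y : p x y < p x x + ε}`. -/
def pmTop {X : Type*} (p : X → X → ℝ) : TopologicalSpace X :=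
  TopologicalSpace.generateFrom
    {s : Set X | ∃ c : X, ∃ ε : ℝ, 0 < ε ∧ s = {y : X | p c y < p c c + ε}}

/-- `p(x, A) = inf {p(x, a) : a ∈ A}`. -/
noncomputable def pmDist {X : Type*} (p : X → X → ℝ) (x : X) (A : Set X) : ℝ :=
  sInf ((fun a => p x a) '' A)

/-- `p(A, x) = inf {p(a, x) : a ∈ A}`. -/
noncomputable def pmDistL {X : Type*} (p : X → X → ℝ) (A : Set X) (x : X) : ℝ :=
  sInf ((fun a => p a x) '' A)

/-- `δ_p(A, B) = sup {p(a, B) : a ∈ A}`. -/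
noncomputable def pmDelta {X : Type*} (p : X → X → ℝ) (A B : Set X) : ℝ :=
  sSup ((fun a => pmDist p a B) '' A)

/-- `H_p(A, B) = max {δ_p(A, B), δ_p(B, A)}`. -/
noncomputable def pmH {X : Type*} (p : X → X → ℝ) (A B : Set X) : ℝ :=
  max (pmDelta p A B) (pmDelta p B A)

/-- A subset `A` is bounded if there are `x₀ ∈ X` and `M ≥ 0` with `p x₀ a ≤ M` for all
`a ∈ A`. -/
def pmBounded {X : Type*} (p : X → X → ℝ) (A : Set X) : Prop :=
  ∃ x₀ : X, ∃ M : ℝ, 0 ≤ M ∧ ∀ a ∈ A, p x₀ a ≤ M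

/-- A sequence is Cauchy in a partial metric space if `p (x n) (x m)` converges to some
real number as `n, m → ∞`. -/
def pmCauchy {X : Type*} (p : X → X → ℝ) (x : ℕ → X) : Prop :=
  ∃ a : ℝ, Filter.Tendsto (fun q : ℕ × ℕ => p (x q.1) (x q.2))
    (Filter.atTop ×ˢ Filter.atTop) (nhds a)

/-- A sequence converges to `l` in a partial metric space if
`lim p (x n) l = lim p (x n) (x n) = p l l`. -/
def pmConvergesTo {X : Type*} (p : X → X → ℝ) (x : ℕ → X) (l : X) : Prop :=
  Filter.Tendsto (fun n => p (x n) l) Filter.atTop (nhds (p l l)) ∧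
  Filter.Tendsto (fun n => p (x n) (x n)) Filter.atTop (nhds (p l l))

/-- A partial metric space is complete if every Cauchy sequence converges. -/
def pmComplete {X : Type*} (p : X → X → ℝ) : Prop :=
  ∀ x : ℕ → X, pmCauchy p x → ∃ l : X, pmConvergesTo p x l

theorem pmDistL_eq_pmDist {X : Type*} {p : X → X → ℝ} (hp3 : ∀ x y : X, p x y = p y x)
    (A : Set X) (x : X) : pmDistL p A x = pmDist p x A := by
  simp only [pmDistL, pmDist, hp3 _ x]

theorem pmDist_le {X : Type*} {p : X → X → ℝ} (hnn : ∀ x y : X, 0 ≤ p x y) {A : Set X} {a : X}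
    (ha : a ∈ A) (x : X) : pmDist p x A ≤ p x a :=
  csInf_le ⟨0, by rintro _ ⟨b, -, rfl⟩; exact hnn x b⟩ ⟨a, ha, rfl⟩

theorem pmDist_nonneg {X : Type*} {p : X → X → ℝ} (hnn : ∀ x y : X, 0 ≤ p x y) (x : X)
    (A : Set X) : 0 ≤ pmDist p x A :=
  Real.sInf_nonneg (by rintro _ ⟨b, -, rfl⟩; exact hnn x b)

theorem exists_lt_of_pmDist_lt {X : Type*} {p : X → X → ℝ} {A : Set X} (hA : A.Nonempty) {x : X}
    {r : ℝ} (h : pmDist p x A < r) : ∃ a ∈ A, p x a < r := by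
  obtain ⟨_, ⟨a, ha, rfl⟩, har⟩ := exists_lt_of_csInf_lt (hA.image _) h
  exact ⟨a, ha, har⟩

theorem pmDist_triangle {X : Type*} {p : X → X → ℝ} (hnn : ∀ x y : X, 0 ≤ p x y)
    (htri : ∀ x y z : X, p x y ≤ p x z + p z y) {A : Set X} (hA : A.Nonempty) (x y : X) :
    pmDist p x A ≤ p x y + pmDist p y A := by
  refine le_of_forall_pos_le_add fun ε hε => ?_
  obtain ⟨a, ha, h⟩ := exists_lt_of_pmDist_lt hA (lt_add_of_pos_right (pmDist p y A) hε)
  linarith [pmDist_le hnn ha x, htri x a y]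

theorem pmDist_le_pmH {X : Type*} {p : X → X → ℝ} (hnn : ∀ x y : X, 0 ≤ p x y)
    (hp3 : ∀ x y : X, p x y = p y x) (htri : ∀ x y z : X, p x y ≤ p x z + p z y)
    {A B : Set X} (hA : pmBounded p A) (hB : B.Nonempty) {a : X} (ha : a ∈ A) :
    pmDist p a B ≤ pmH p A B := by
  obtain ⟨x₀, M, -, hM⟩ := hA
  obtain ⟨b, hb⟩ := hB
  suffices hbdd : BddAbove ((fun a => pmDist p a B) '' A) from
    (le_csSup hbdd ⟨a, ha, rfl⟩).trans (le_max_left _ _)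
  refine ⟨M + p x₀ b, ?_⟩
  rintro _ ⟨c, hc, rfl⟩
  have := hM c hc
  rw [hp3] at this
  linarith [pmDist_le hnn hb c, htri c b x₀]

theorem exists_ball_subset_of_isOpen_pmTop {X : Type*} {p : X → X → ℝ}
    (hp4 : ∀ x y z : X, p x y ≤ p x z + p z y - p z z) {U : Set X}
    (hU : @IsOpen X (pmTop p) U) :
    ∀ x ∈ U, ∃ δ > 0, ∀ y, p x y < p x x + δ → y ∈ U := by
  induction hU with
  | basic s hs =>
    obtain ⟨c, ε, -, rfl⟩ := hs
    intro x hx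
    simp only [Set.mem_ofPred_eq] at hx
    refine ⟨p c c + ε - p c x, by linarith, fun y hy => ?_⟩
    simp only [Set.mem_ofPred_eq]
    linarith [hp4 c y x]
  | univ => exact fun x _ => ⟨1, one_pos, fun _ _ => trivial⟩
  | inter s t _ _ ihs iht =>
    rintro x ⟨hxs, hxt⟩
    obtain ⟨δ, hδ, h⟩ := ihs x hxs
    obtain ⟨η, hη, h'⟩ := iht x hxt
    refine ⟨min δ η, lt_min hδ hη, fun y hy => ⟨h y ?_, h' y ?_⟩⟩
    · linarith [min_le_left δ η]
    · linarith [min_le_right δ η]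
  | sUnion S _ ih =>
    rintro x ⟨s, hs, hxs⟩
    obtain ⟨δ, hδ, h⟩ := ih s hs x hxs
    exact ⟨δ, hδ, fun y hy => ⟨s, hs, h y hy⟩⟩

theorem mem_of_pmDist_le_self {X : Type*} {p : X → X → ℝ}
    (hp4 : ∀ x y z : X, p x y ≤ p x z + p z y - p z z) {A : Set X} (hA : A.Nonempty)
    (hc : @IsClosed X (pmTop p) A) {x : X} (hx : pmDist p x A ≤ p x x) : x ∈ A := by
  by_contra hxA
  obtain ⟨δ, hδ, h⟩ := exists_ball_subset_of_isOpen_pmTop hp4 hc.isOpen_compl x hxA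
  obtain ⟨a, ha, hxa⟩ := exists_lt_of_pmDist_lt hA (hx.trans_lt (lt_add_of_pos_right _ hδ))
  exact h a hxa ha

/-- Geometrically decaying consecutive distances force all mutual distances to tend to `0`. -/
theorem tendsto_zero_of_le_geometric {X : Type*} {p : X → X → ℝ}
    (hp1 : ∀ x y : X, 0 ≤ p x x ∧ p x x ≤ p x y) (hp3 : ∀ x y : X, p x y = p y x)
    (htri : ∀ x y z : X, p x y ≤ p x z + p z y) {k C : ℝ} (hk0 : 0 ≤ k) (hk1 : k < 1)
    (hC : 0 ≤ C) {x : ℕ → X} (hx : ∀ n, p (x n) (x (n + 1)) ≤ C * k ^ n) :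
    Filter.Tendsto (fun q : ℕ × ℕ => p (x q.1) (x q.2))
      (Filter.atTop ×ˢ Filter.atTop) (nhds 0) := by
  have h1k : 0 < 1 - k := by linarith
  obtain ⟨E, hE⟩ : ∃ E, E = C / (1 - k) := ⟨_, rfl⟩
  have hE0 : 0 ≤ E := hE ▸ by positivity
  have hCE : C = E * (1 - k) := by rw [hE]; field_simp
  have key (n j : ℕ) : p (x n) (x (n + j)) + E * k ^ (n + j) ≤ (C + E) * k ^ n := by
    induction j with
    | zero => simpa [add_mul] using ((hp1 _ _).2.trans (hx n))
    | succ j ih =>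
      have h := htri (x n) (x (n + j + 1)) (x (n + j))
      have h' := hx (n + j)
      rw [← add_assoc, pow_succ]
      rw [hCE] at h' ⊢
      rw [hCE] at ih
      linarith
  have bound (n m : ℕ) (hnm : n ≤ m) : p (x n) (x m) ≤ (C + E) * k ^ n := by
    obtain ⟨j, rfl⟩ := Nat.exists_eq_add_of_le hnm
    have := key n j
    have : 0 ≤ E * k ^ (n + j) := by positivity
    linarith
  have hpow := tendsto_pow_atTop_nhds_zero_of_lt_one hk0 hk1
  have hlim : Filter.Tendsto (fun q : ℕ × ℕ => (C + E) * (k ^ q.1 + k ^ q.2))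
      (Filter.atTop ×ˢ Filter.atTop) (nhds 0) := by
    simpa using ((hpow.comp Filter.tendsto_fst).add (hpow.comp Filter.tendsto_snd)).const_mul (C + E)
  refine squeeze_zero (fun q => (hp1 _ (x q.2)).1.trans (hp1 _ _).2) (fun ⟨n, m⟩ => ?_) hlim
  have hn : 0 ≤ (C + E) * k ^ n := by positivity
  have hm : 0 ≤ (C + E) * k ^ m := by positivity
  rcases le_total n m with h | h
  · linarith [bound n m h]
  · have := bound m n h
    rw [hp3] at this
    linarith

/-- Kannan-type fixed point theorem for multi-valued maps. -/
theorem kannan_multivalued_fixed_point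
    {X : Type*} [Nonempty X] (p : X → X → ℝ)
    (hp1 : ∀ x y : X, 0 ≤ p x x ∧ p x x ≤ p x y)
    (hp2 : ∀ x y : X, x = y ↔ (p x x = p x y ∧ p x y = p y y))
    (hp3 : ∀ x y : X, p x y = p y x)
    (hp4 : ∀ x y z : X, p x y ≤ p x z + p z y - p z z)
    (hcomplete : pmComplete p)
    (T : X → Set X)
    (hT : ∀ x : X, (T x).Nonempty ∧ @IsClosed X (pmTop p) (T x) ∧ pmBounded p (T x))
    (l : ℝ) (hl0 : 0 < l) (hl : l < 1 / 2)
    (hcontr : ∀ x y : X,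
      pmH p (T x) (T y) ≤ l * (pmDistL p (T x) x + pmDistL p (T y) y)) :
    ∃ x : X, x ∈ T x := by
  have hnn (x y : X) : 0 ≤ p x y := (hp1 x y).1.trans (hp1 x y).2
  have htri (x y z : X) : p x y ≤ p x z + p z y := by linarith [hp4 x y z, (hp1 z z).1]
  simp only [pmDistL_eq_pmDist hp3] at hcontr
  have hdist {x y : X} (hy : y ∈ T x) (z : X) :
      pmDist p y (T z) ≤ l * (pmDist p x (T x) + pmDist p z (T z)) :=
    (pmDist_le_pmH hnn hp3 htri (hT x).2.2 (hT z).1 hy).trans (hcontr x z)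
  obtain ⟨k, hk⟩ : ∃ k, k = l / (1 - l) := ⟨_, rfl⟩
  have h1l : 0 < 1 - l := by linarith
  have hk0 : 0 < k := hk ▸ by positivity
  have hk1 : k < 1 := by rw [hk, div_lt_one h1l]; linarith
  have hstep {x y : X} (hy : y ∈ T x) : pmDist p y (T y) ≤ k * pmDist p x (T x) := by
    rw [hk, div_mul_eq_mul_div, le_div_iff₀ h1l]
    linarith [hdist hy y]
  choose f hfT hf using fun (n : ℕ) (x : X) =>
    exists_lt_of_pmDist_lt (hT x).1 (lt_add_of_pos_right (pmDist p x (T x)) (pow_pos hk0 n))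
  obtain ⟨x₀⟩ := ‹Nonempty X›
  let x : ℕ → X := fun n => Nat.rec x₀ f n
  have hxT (n : ℕ) : x (n + 1) ∈ T (x n) := hfT n (x n)
  have hD (n : ℕ) : pmDist p (x n) (T (x n)) ≤ pmDist p x₀ (T x₀) * k ^ n := by
    induction n with
    | zero => simp [x]
    | succ n ih =>
      calc _ ≤ k * pmDist p (x n) (T (x n)) := hstep (hxT n)
        _ ≤ k * (pmDist p x₀ (T x₀) * k ^ n) := by gcongr
        _ = _ := by ring
  have hD0 : 0 ≤ pmDist p x₀ (T x₀) := pmDist_nonneg hnn _ _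
  have hlim := tendsto_zero_of_le_geometric hp1 hp3 htri hk0.le hk1
    (add_nonneg hD0 zero_le_one) (x := x) fun n => by
      have : p (x n) (x (n + 1)) < pmDist p (x n) (T (x n)) + k ^ n := hf n (x n)
      linarith [hD n]
  obtain ⟨z, hz, hzz⟩ := hcomplete x ⟨0, hlim⟩
  have hself : p z z = 0 := tendsto_nhds_unique hzz
    (hlim.comp (Filter.tendsto_id.prodMk Filter.tendsto_id))
  rw [hself] at hz
  refine ⟨z, mem_of_pmDist_le_self hp4 (hT z).1 (hT z).2.1 ?_⟩
  have hbound (n : ℕ) : pmDist p z (T z) ≤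
      p (x (n + 1)) z + l * (pmDist p x₀ (T x₀) * k ^ n + pmDist p z (T z)) :=
    calc pmDist p z (T z) ≤ p z (x (n + 1)) + pmDist p (x (n + 1)) (T z) :=
          pmDist_triangle hnn htri (hT z).1 _ _
      _ ≤ p (x (n + 1)) z + l * (pmDist p (x n) (T (x n)) + pmDist p z (T z)) := by
          rw [hp3 z]
          gcongr
          exact hdist (hxT n) z
      _ ≤ _ := by gcongr; exact hD n
  have hle := ge_of_tendsto' ((hz.comp (Filter.tendsto_add_atTop_nat 1)).add
    ((((tendsto_pow_atTop_nhds_zero_of_lt_one hk0.le hk1).const_mul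
      (pmDist p x₀ (T x₀))).add_const (pmDist p z (T z))).const_mul l)) hbound
  simp only [mul_zero, zero_add] at hle
  rw [hself]
  nlinarith
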